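/- (Restricted isometry property.) Let p be a sampling distribution on {1,…,n} and let ω_1,…,ω_m be drawn independently from {1,…,n} with ℙ(ω_j = i) = p_i. Let M ∈ ℝ^{m×n} be the sampling matrix with M_{ij} = 1 if j = ω_i and 0 otherwise, and P = diag(p). For any δ, ε ∈ (0,1), if m ≥ (3/δ²)(ν_p^k)² log(2k/ε), then with probability at least 1−ε over the draw of ω_1,…,ω_m, one has (1−δ)‖x‖₂² ≤ (1/m)‖M P^{−1/2} x‖₂² ≤ (1+δ)‖x‖₂² for all x ∈ span(U_k). -/

import Mathlib

open Matrix

/-- Euclidean norm of a finite real vector. -/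
noncomputable def norm2 {d : ℕ} (x : Fin d → ℝ) : ℝ := Real.sqrt (∑ j, x j ^ 2)

/-- The sampling matrix `M ∈ ℝ^{m×n}` associated to drawn indices `ω`:
`M i j = 1` if `j = ω i` and `0` otherwise. -/
def sampMat {n m : ℕ} (ω : Fin m → Fin n) : Matrix (Fin m) (Fin n) ℝ :=
  Matrix.of fun i j => if j = ω i then 1 else 0

/-- `P^{-1/2}` for `P = diag(p)`. -/
noncomputable def pInvSqrt {n : ℕ} (p : Fin n → ℝ) : Matrix (Fin n) (Fin n) ℝ :=
  Matrix.diagonal fun i => (Real.sqrt (p i))⁻¹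


theorem rip_pow_sub {A : Type*} [NormedRing A] [NormOneClass A] (X Y : A) (K : ℝ) (hK : 1 ≤ K)
    (hX : ‖X‖ ≤ K) (hY : ‖Y‖ ≤ K) (N : ℕ) : ‖X ^ N - Y ^ N‖ ≤ N * K ^ N * ‖X - Y‖ := by
  induction N with
  | zero => simp
  | succ N ih =>
    have e : X ^ (N+1) - Y ^ (N+1) = X ^ N * (X - Y) + (X ^ N - Y ^ N) * Y := by
      rw [pow_succ, pow_succ]; noncomm_ring
    have hK0 : 0 ≤ K := by linarith
    have h1 : ‖X ^ N‖ ≤ K ^ N := (norm_pow_le X N).trans (pow_le_pow_left₀ (norm_nonneg _) hX N)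
    have h2 : ‖X ^ N * (X - Y)‖ ≤ K ^ (N+1) * ‖X - Y‖ := by
      refine (norm_mul_le _ _).trans ?_
      gcongr
      exact h1.trans (pow_le_pow_right₀ hK (by lia))
    have h3 : ‖(X ^ N - Y ^ N) * Y‖ ≤ N * K ^ (N+1) * ‖X - Y‖ := by
      refine (norm_mul_le _ _).trans ?_
      calc _ ≤ (N * K ^ N * ‖X - Y‖) * K := by gcongr
        _ = _ := by ring
    rw [e]
    refine (norm_add_le _ _).trans ?_
    push_cast
    linarith

theorem rip_trotter {A : Type*} [NormedRing A] [NormOneClass A] [NormedAlgebra ℝ A]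
    [CompleteSpace A] (a b : A) :
    Filter.Tendsto (fun N : ℕ => (NormedSpace.exp ((N:ℝ)⁻¹ • a) * NormedSpace.exp ((N:ℝ)⁻¹ • b)) ^ N)
      Filter.atTop (nhds (NormedSpace.exp (a + b))) := by
  let _ : NormedAlgebra ℚ A := NormedAlgebra.restrictScalars ℚ ℝ A
  set f : ℝ → A := fun t => NormedSpace.exp (t • a) * NormedSpace.exp (t • b) with hf
  set g : ℝ → A := fun t => NormedSpace.exp (t • (a + b)) with hg
  have hf' : HasDerivAt f (a + b) 0 := by
    have := (hasDerivAt_exp_smul_const (𝕂 := ℝ) a 0).mul (hasDerivAt_exp_smul_const (𝕂 := ℝ) b 0)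
    simp only [zero_smul, NormedSpace.exp_zero, one_mul, mul_one] at this
    exact this
  have hg' : HasDerivAt g (a + b) 0 := by
    have := hasDerivAt_exp_smul_const (𝕂 := ℝ) (a+b) 0
    simp only [zero_smul, NormedSpace.exp_zero, one_mul] at this
    exact this
  have hf0 : f 0 = 1 := by simp [hf]
  have hg0 : g 0 = 1 := by simp [hg]
  have htend : Filter.Tendsto (fun N : ℕ => (N:ℝ)⁻¹) Filter.atTop (nhds 0) :=
    tendsto_inv_atTop_nhds_zero_nat
  have hd : (fun t => f t - g t) =o[nhds 0] (fun t : ℝ => t) := by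
    have := (hf'.sub hg').isLittleO
    simpa [hf0, hg0] using this
  have hd2 := hd.comp_tendsto htend
  obtain ⟨C1, hC1⟩ := (hf'.isBigO_sub.comp_tendsto htend).bound
  obtain ⟨C2, hC2⟩ := (hg'.isBigO_sub.comp_tendsto htend).bound
  set C := max (max C1 C2) 0 with hC
  have key : Filter.Tendsto (fun N : ℕ => f (N:ℝ)⁻¹ ^ N - g (N:ℝ)⁻¹ ^ N) Filter.atTop (nhds 0) := by
    rw [Metric.tendsto_nhds]
    intro e he
    have hpos : 0 < e / (2 * Real.exp C) := by positivity
    filter_upwards [hC1, hC2, hd2.bound hpos, Filter.eventually_gt_atTop 0] with N h1 h2 h3 hN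
    have hN' : (0:ℝ) < N := by exact_mod_cast hN
    simp only [Function.comp, hf0, hg0, sub_zero] at h1 h2 h3
    have hi : ‖(N:ℝ)⁻¹‖ = (N:ℝ)⁻¹ := by simp
    rw [hi] at h1 h2 h3
    have hC0 : 0 ≤ C := le_max_right _ _
    have hX : ‖f (N:ℝ)⁻¹‖ ≤ 1 + C * (N:ℝ)⁻¹ := by
      have : f (N:ℝ)⁻¹ = 1 + (f (N:ℝ)⁻¹ - 1) := by abel
      rw [this]
      refine (norm_add_le _ _).trans ?_
      rw [norm_one]
      have : C1 ≤ C := (le_max_left _ _).trans (le_max_left _ _)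
      gcongr
      exact h1.trans (by gcongr)
    have hY : ‖g (N:ℝ)⁻¹‖ ≤ 1 + C * (N:ℝ)⁻¹ := by
      have : g (N:ℝ)⁻¹ = 1 + (g (N:ℝ)⁻¹ - 1) := by abel
      rw [this]
      refine (norm_add_le _ _).trans ?_
      rw [norm_one]
      have : C2 ≤ C := (le_max_right _ _).trans (le_max_left _ _)
      gcongr
      exact h2.trans (by gcongr)
    have hK : (1 + C * (N:ℝ)⁻¹) ^ N ≤ Real.exp C := by
      calc _ ≤ (Real.exp (C * (N:ℝ)⁻¹)) ^ N := by
            gcongr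
            linarith [Real.add_one_le_exp (C * (N:ℝ)⁻¹)]
        _ = _ := by rw [← Real.exp_nat_mul]; congr 1; field_simp
    have := rip_pow_sub _ _ _ (by have : 0 ≤ C * (N:ℝ)⁻¹ := by positivity
                                  linarith) hX hY N
    rw [dist_zero_right]
    calc _ ≤ _ := this
      _ ≤ N * Real.exp C * (e / (2 * Real.exp C) * (N:ℝ)⁻¹) := by gcongr
      _ = e / 2 := by field_simp
      _ < e := by linarith
  have hgN : ∀ᶠ N : ℕ in Filter.atTop, g (N:ℝ)⁻¹ ^ N = NormedSpace.exp (a + b) := by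
    filter_upwards [Filter.eventually_gt_atTop 0] with N hN
    have hN' : (N:ℝ) ≠ 0 := by positivity
    rw [hg]
    simp only
    rw [← NormedSpace.exp_nsmul, ← Nat.cast_smul_eq_nsmul ℝ, smul_smul, mul_inv_cancel₀ hN', one_smul]
  have h3 := key.add_const (NormedSpace.exp (a + b))
  rw [zero_add] at h3
  refine h3.congr' ?_
  filter_upwards [hgN] with N hN
  rw [hN]; simp [hf]

section tr
variable {k : ℕ}

theorem rip_cs (X Y : Matrix (Fin k) (Fin k) ℝ) :
    2 * trace (X * Y) ≤ trace (X * Xᵀ) + trace (Y * Yᵀ) := by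
  have h : 0 ≤ trace ((X - Yᵀ) * (X - Yᵀ)ᵀ) := by
    simp only [trace, diag, mul_apply, transpose_apply]
    exact Finset.sum_nonneg fun i _ => Finset.sum_nonneg fun j _ => mul_self_nonneg _
  have e : trace ((X - Yᵀ) * (X - Yᵀ)ᵀ) = trace (X * Xᵀ) + trace (Y * Yᵀ) - 2 * trace (X * Y) := by
    rw [transpose_sub, transpose_transpose, sub_mul, mul_sub, mul_sub, trace_sub, trace_sub, trace_sub]
    rw [trace_mul_comm Yᵀ Y, ← trace_transpose (Yᵀ * Xᵀ), transpose_mul]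
    simp only [transpose_transpose]
    ring
  linarith

theorem rip_trace_pow_comm (A B : Matrix (Fin k) (Fin k) ℝ) (N : ℕ) :
    trace ((A * B) ^ N) = trace ((B * A) ^ N) := by
  cases N with
  | zero => simp
  | succ N =>
    have : (A * B) ^ (N+1) = A * ((B * A) ^ N * B) := by
      induction N with
      | zero => simp
      | succ N ih => rw [pow_succ, ih, pow_succ]; simp only [mul_assoc]
    rw [this, trace_mul_comm, pow_succ, mul_assoc]

theorem rip_PQ (j : ℕ) :
    (∀ Z : Matrix (Fin k) (Fin k) ℝ, trace (Z ^ 2 ^ (j+1)) ≤ trace ((Z * Zᵀ) ^ 2 ^ j)) ∧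
    (∀ A B : Matrix (Fin k) (Fin k) ℝ, Aᵀ = A → Bᵀ = B →
      trace ((A * B) ^ 2 ^ j) ≤ trace (A ^ 2 ^ j * B ^ 2 ^ j)) := by
  induction j with
  | zero =>
    refine ⟨fun Z => ?_, fun A B _ _ => by simp⟩
    have := rip_cs Z Z
    simp only [zero_add, pow_one, pow_zero]
    rw [pow_two]; linarith
  | succ j ih =>
    obtain ⟨P, Q⟩ := ih
    have Q' : ∀ A B : Matrix (Fin k) (Fin k) ℝ, Aᵀ = A → Bᵀ = B →
      trace ((A * B) ^ 2 ^ (j+1)) ≤ trace (A ^ 2 ^ (j+1) * B ^ 2 ^ (j+1)) := by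
      intro A B hA hB
      refine (P (A * B)).trans ?_
      have e : A * B * (A * B)ᵀ = A * (B * B * A) := by
        rw [transpose_mul, hA, hB]; simp only [mul_assoc]
      rw [e, rip_trace_pow_comm, mul_assoc (B * B), rip_trace_pow_comm]
      refine (Q (A * A) (B * B) (by rw [transpose_mul, hA]) (by rw [transpose_mul, hB])).trans ?_
      rw [← pow_two, ← pow_two, ← pow_mul, ← pow_mul, pow_succ' 2 j]
    refine ⟨fun Z => ?_, Q'⟩
    have h1 := P (Z ^ 2)
    rw [← pow_mul, ← pow_succ'] at h1
    refine h1.trans ?_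
    have e : Z ^ 2 * (Z ^ 2)ᵀ = Z * (Z * Zᵀ * Zᵀ) := by
      rw [transpose_pow, pow_two, pow_two]; simp only [mul_assoc]
    rw [e, rip_trace_pow_comm, mul_assoc (Z * Zᵀ)]
    have hs1 : (Z * Zᵀ)ᵀ = Z * Zᵀ := by simp
    have hs2 : (Zᵀ * Z)ᵀ = Zᵀ * Z := by simp
    refine (Q _ _ hs1 hs2).trans ?_
    have := rip_cs ((Z * Zᵀ) ^ 2 ^ j) ((Zᵀ * Z) ^ 2 ^ j)
    rw [transpose_pow, transpose_pow, hs1, hs2, ← pow_add, ← pow_add, rip_trace_pow_comm Zᵀ Z] at this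
    have e2 : 2 ^ j + 2 ^ j = 2 ^ (j+1) := by ring
    rw [e2] at this
    linarith

open scoped Matrix.Norms.Operator in
theorem rip_golden_thompson (hk : 0 < k) (A B : Matrix (Fin k) (Fin k) ℝ) (hA : Aᵀ = A) (hB : Bᵀ = B) :
    trace (NormedSpace.exp (A + B)) ≤ trace (NormedSpace.exp A * NormedSpace.exp B) := by
  have : Nonempty (Fin k) := ⟨⟨0, hk⟩⟩
  have h := rip_trotter A B
  have h2 := h.comp (tendsto_pow_atTop_atTop_of_one_lt (r := 2) (by norm_num : 1 < 2))
  have hc : Continuous (fun M : Matrix (Fin k) (Fin k) ℝ => trace M) := by fun_prop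
  have h3 := (hc.tendsto _).comp h2
  refine le_of_tendsto h3 (Filter.Eventually.of_forall fun j => ?_)
  simp only [Function.comp]
  have hs : ∀ A : Matrix (Fin k) (Fin k) ℝ, Aᵀ = A → ∀ t : ℝ,
      (NormedSpace.exp (t • A))ᵀ = NormedSpace.exp (t • A) := by
    intro A hA t
    rw [← Matrix.exp_transpose, transpose_smul, hA]
  have hp : ∀ A : Matrix (Fin k) (Fin k) ℝ,
      (NormedSpace.exp (((2 ^ j : ℕ) : ℝ)⁻¹ • A)) ^ 2 ^ j = NormedSpace.exp A := by
    intro A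
    rw [← Matrix.exp_nsmul, ← Nat.cast_smul_eq_nsmul ℝ, smul_smul, mul_inv_cancel₀ (by positivity), one_smul]
  have := (rip_PQ (k := k) j).2 _ _ (hs A hA (((2 ^ j : ℕ) : ℝ)⁻¹)) (hs B hB (((2 ^ j : ℕ) : ℝ)⁻¹))
  rw [hp, hp] at this
  exact this
end tr

theorem rip_markov {k : ℕ} (H : Matrix (Fin k) (Fin k) ℝ) (hH : Hᵀ = H) (α : Fin k → ℝ)
    (hα : α ⬝ᵥ α = 1) : Real.exp (α ⬝ᵥ H *ᵥ α) ≤ trace (NormedSpace.exp H) := by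
  have hh : H.IsHermitian := by
    rw [Matrix.IsHermitian, conjTranspose_eq_transpose_of_trivial, hH]
  set V : Matrix (Fin k) (Fin k) ℝ := (hh.eigenvectorUnitary : Matrix (Fin k) (Fin k) ℝ) with hV
  set d := hh.eigenvalues with hd
  have hVV : V * Vᵀ = 1 := by
    have := Unitary.coe_mul_star_self hh.eigenvectorUnitary
    rw [Unitary.coe_star, star_eq_conjTranspose, conjTranspose_eq_transpose_of_trivial] at this
    exact this
  have hVV' : Vᵀ * V = 1 := mul_eq_one_comm.mp hVV
  have hs : H = V * diagonal d * Vᵀ := by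
    have := hh.spectral_theorem
    rw [Unitary.conjStarAlgAut_apply] at this
    rw [star_eq_conjTranspose, conjTranspose_eq_transpose_of_trivial] at this
    exact this
  have hinv : V⁻¹ = Vᵀ := inv_eq_right_inv hVV
  have hu : IsUnit V := IsUnit.of_mul_eq_one _ hVV
  have htr : trace (NormedSpace.exp H) = ∑ i, Real.exp (d i) := by
    rw [hs, ← hinv, Matrix.exp_conj _ _ hu, trace_mul_comm, ← mul_assoc, hinv, hVV', one_mul,
      Matrix.exp_diagonal, trace_diagonal]
    simp [Real.exp_eq_exp_ℝ, Pi.coe_exp]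
  have hq : α ⬝ᵥ H *ᵥ α = ∑ i, (Vᵀ *ᵥ α) i ^ 2 * d i := by
    rw [hs, ← mulVec_mulVec, ← mulVec_mulVec, dotProduct_mulVec, ← mulVec_transpose]
    simp only [dotProduct, mulVec_diagonal]
    exact Finset.sum_congr rfl fun i _ => by ring
  have hb : ∑ i, (Vᵀ *ᵥ α) i ^ 2 = 1 := by
    have : (Vᵀ *ᵥ α) ⬝ᵥ (Vᵀ *ᵥ α) = 1 := by
      rw [dotProduct_mulVec, vecMul_transpose, mulVec_mulVec, hVV, one_mulVec, hα]
    rw [← this]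
    simp only [dotProduct, pow_two]
  rw [htr, hq]
  have hj := convexOn_exp.map_sum_le (t := Finset.univ) (w := fun i => (Vᵀ *ᵥ α) i ^ 2) (p := d)
    (fun i _ => sq_nonneg _) hb (fun i _ => Set.mem_univ _)
  simp only [smul_eq_mul] at hj
  refine hj.trans (Finset.sum_le_sum fun i _ => ?_)
  have : (Vᵀ *ᵥ α) i ^ 2 ≤ 1 := by
    rw [← hb]
    exact Finset.single_le_sum (f := fun i => (Vᵀ *ᵥ α) i ^ 2) (fun i _ => sq_nonneg _) (Finset.mem_univ i)
  nlinarith [Real.exp_pos (d i)]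

open scoped Matrix.Norms.Operator in
theorem rip_rank_one {k : ℕ} (v : Fin k → ℝ) (θ : ℝ) :
    (v ⬝ᵥ v) • NormedSpace.exp (θ • vecMulVec v v) =
      (v ⬝ᵥ v) • (1 : Matrix (Fin k) (Fin k) ℝ) + (Real.exp (θ * (v ⬝ᵥ v)) - 1) • vecMulVec v v := by
  set r := v ⬝ᵥ v with hr
  set W := vecMulVec v v with hW
  have hWW : W * W = r • W := by
    rw [hW, vecMulVec_mul_vecMulVec, ← hr]
    ext i j; simp [vecMulVec_apply]
    try ring
  have hpow : ∀ N : ℕ, r • W ^ (N+1) = r ^ (N+1) • W := by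
    intro N
    induction N with
    | zero => simp
    | succ N ih => rw [pow_succ, ← smul_mul_assoc, ih, smul_mul_assoc, hWW, smul_smul, ← pow_succ]
  have h1 := (NormedSpace.exp_series_hasSum_exp' (𝕂 := ℝ) (θ • W)).const_smul r
  have h2 := (NormedSpace.exp_series_hasSum_exp' (𝕂 := ℝ) (θ * r)).smul_const W
  have h3 : HasSum (fun N : ℕ => if N = 0 then r • (1 : Matrix (Fin k) (Fin k) ℝ) - W else 0)
      (r • (1 : Matrix (Fin k) (Fin k) ℝ) - W) := hasSum_ite_eq 0 _
  have h4 := h2.add h3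
  have : (fun N : ℕ => r • ((N.factorial : ℝ)⁻¹ • (θ • W) ^ N)) = (fun N : ℕ => ((N.factorial : ℝ)⁻¹ • (θ * r) ^ N) • W +
      (if N = 0 then r • (1 : Matrix (Fin k) (Fin k) ℝ) - W else 0)) := by
    funext N
    cases N with
    | zero => simp
    | succ N =>
      rw [smul_comm, smul_pow, smul_comm r, hpow]
      simp only [Nat.add_eq_zero_iff, one_ne_zero, and_false, if_false, add_zero, smul_smul, smul_eq_mul]
      congr 1
      rw [mul_pow]
  rw [this] at h1
  refine (h1.unique h4).trans ?_
  rw [← Real.exp_eq_exp_ℝ, sub_smul, one_smul]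
  abel

theorem rip_exp_psd {k : ℕ} (A : Matrix (Fin k) (Fin k) ℝ) (hA : Aᵀ = A) (v : Fin k → ℝ) :
    0 ≤ v ⬝ᵥ NormedSpace.exp A *ᵥ v := by
  set E := NormedSpace.exp ((2:ℝ)⁻¹ • A) with hE
  have hEs : Eᵀ = E := by rw [hE, ← Matrix.exp_transpose, transpose_smul, hA]
  have : NormedSpace.exp A = E * E := by
    rw [hE, ← Matrix.exp_add_of_commute _ _ (Commute.refl _), ← add_smul]; norm_num
  rw [this, ← mulVec_mulVec, dotProduct_mulVec, ← mulVec_transpose, hEs]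
  exact Finset.sum_nonneg fun i _ => mul_self_nonneg _

theorem rip_step1 {k : ℕ} (hk : 0 < k) (A : Matrix (Fin k) (Fin k) ℝ) (hA : Aᵀ = A) (v : Fin k → ℝ)
    (θ R : ℝ) (hR : 0 < R) (hv : v ⬝ᵥ v ≤ R) :
    trace (NormedSpace.exp (A + θ • vecMulVec v v)) ≤
      trace (NormedSpace.exp A) + (Real.exp (θ * R) - 1) / R * (v ⬝ᵥ NormedSpace.exp A *ᵥ v) := by
  have hr0 : 0 ≤ v ⬝ᵥ v := Finset.sum_nonneg fun i _ => mul_self_nonneg _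
  rcases hr0.eq_or_lt with h0 | hpos
  · have : v = 0 := dotProduct_self_eq_zero.mp h0.symm
    subst this
    simp
  set r := v ⬝ᵥ v with hr
  refine (rip_golden_thompson hk A _ hA (by simp [transpose_vecMulVec])).trans ?_
  have h1 := rip_rank_one v θ
  rw [← hr] at h1
  have h2 : NormedSpace.exp (θ • vecMulVec v v) = 1 + ((Real.exp (θ * r) - 1) / r) • vecMulVec v v := by
    have := congrArg (fun M => r⁻¹ • M) h1
    simp only [smul_add, smul_smul, inv_mul_cancel₀ hpos.ne', one_smul] at this
    rw [this]; congr 2; field_simp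
  rw [h2, mul_add, mul_one, trace_add, mul_smul_comm, trace_smul, smul_eq_mul]
  have h3 : trace (NormedSpace.exp A * vecMulVec v v) = v ⬝ᵥ NormedSpace.exp A *ᵥ v := by
    rw [mul_vecMulVec, trace_vecMulVec, dotProduct_comm]
  rw [h3]
  have h4 : (Real.exp (θ * r) - 1) / r ≤ (Real.exp (θ * R) - 1) / R := by
    have hc := convexOn_exp.2 (Set.mem_univ 0) (Set.mem_univ (θ * R))
      (show 0 ≤ 1 - r / R by rw [sub_nonneg, div_le_one hR]; exact hv)
      (show 0 ≤ r / R by positivity) (by ring)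
    simp only [smul_eq_mul, mul_zero, zero_add, Real.exp_zero, mul_one] at hc
    have e : r / R * (θ * R) = θ * r := by field_simp
    rw [e] at hc
    rw [div_le_iff₀ hpos]
    have : (Real.exp (θ * R) - 1) / R * r = r / R * Real.exp (θ * R) - r / R := by field_simp
    linarith
  have := mul_le_mul_of_nonneg_right h4 (rip_exp_psd A hA v)
  linarith

theorem rip_mgf {k n : ℕ} (hk : 0 < k) (p : Fin n → ℝ) (hp : ∀ i, 0 < p i) (hpsum : ∑ i, p i = 1)
    (v : Fin n → Fin k → ℝ) (hI : ∑ i, p i • vecMulVec (v i) (v i) = 1) (θ R : ℝ) (hR : 0 < R)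
    (hv : ∀ i, v i ⬝ᵥ v i ≤ R) (m : ℕ) (A : Matrix (Fin k) (Fin k) ℝ) (hA : Aᵀ = A) :
    ∑ ω : Fin m → Fin n, (∏ j, p (ω j)) *
      trace (NormedSpace.exp (A + ∑ j, θ • vecMulVec (v (ω j)) (v (ω j)))) ≤
      Real.exp (m * ((Real.exp (θ * R) - 1) / R)) * trace (NormedSpace.exp A) := by
  set c := (Real.exp (θ * R) - 1) / R with hc
  have htr : ∀ A : Matrix (Fin k) (Fin k) ℝ, Aᵀ = A → 0 ≤ trace (NormedSpace.exp A) := by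
    intro A hA
    refine Finset.sum_nonneg fun i _ => ?_
    have := rip_exp_psd A hA (Pi.single i 1)
    simpa using this
  induction m generalizing A with
  | zero => simp
  | succ m ih =>
    rw [← (Fin.consEquiv (fun _ : Fin (m+1) => Fin n)).sum_comp, Fintype.sum_prod_type]
    simp only [Fin.consEquiv, Equiv.coe_fn_mk, Fin.prod_univ_succ, Fin.sum_univ_succ, Fin.cons_zero, Fin.cons_succ]
    have hW : ∀ i, (A + θ • vecMulVec (v i) (v i))ᵀ = A + θ • vecMulVec (v i) (v i) := by
      intro i; rw [transpose_add, transpose_smul, transpose_vecMulVec, hA]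
    calc _ = ∑ i, p i * ∑ ω : Fin m → Fin n, (∏ j, p (ω j)) *
          trace (NormedSpace.exp ((A + θ • vecMulVec (v i) (v i)) + ∑ j, θ • vecMulVec (v (ω j)) (v (ω j)))) := by
          refine Finset.sum_congr rfl fun i _ => ?_
          rw [Finset.mul_sum]
          refine Finset.sum_congr rfl fun ω _ => ?_
          rw [add_assoc, mul_assoc]
      _ ≤ ∑ i, p i * (Real.exp (m * c) * (trace (NormedSpace.exp A) + c * (v i ⬝ᵥ NormedSpace.exp A *ᵥ v i))) := by
          refine Finset.sum_le_sum fun i _ => mul_le_mul_of_nonneg_left ?_ (hp i).le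
          refine (ih _ (hW i)).trans ?_
          exact mul_le_mul_of_nonneg_left (rip_step1 hk A hA (v i) θ R hR (hv i)) (Real.exp_pos _).le
      _ = Real.exp (m * c) * ((1 + c) * trace (NormedSpace.exp A)) := by
          have h1 : ∑ i, p i * (v i ⬝ᵥ NormedSpace.exp A *ᵥ v i) = trace (NormedSpace.exp A) := by
            calc _ = trace (NormedSpace.exp A * ∑ i, p i • vecMulVec (v i) (v i)) := by
                  rw [Finset.mul_sum, trace_sum]
                  refine Finset.sum_congr rfl fun i _ => ?_
                  rw [mul_smul_comm, trace_smul, mul_vecMulVec, trace_vecMulVec, dotProduct_comm, smul_eq_mul]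
              _ = _ := by rw [hI, mul_one]
          calc _ = Real.exp (m * c) * ((∑ i, p i) * trace (NormedSpace.exp A) + c * ∑ i, p i * (v i ⬝ᵥ NormedSpace.exp A *ᵥ v i)) := by
                rw [Finset.sum_mul, Finset.mul_sum, ← Finset.sum_add_distrib, Finset.mul_sum]
                exact Finset.sum_congr rfl fun i _ => by ring
            _ = _ := by rw [h1, hpsum]; ring
      _ ≤ Real.exp (m * c) * (Real.exp c * trace (NormedSpace.exp A)) := by
          gcongr
          · exact htr A hA
          · linarith [Real.add_one_le_exp c]
      _ = _ := by
          rw [← mul_assoc, ← Real.exp_add]; congr 2; push_cast; ring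

theorem rip_log (s : ℝ) (h1 : -1 < s) (h2 : s < 1) : s ^ 2 / 3 ≤ (1 + s) * Real.log (1 + s) - s := by
  rcases le_total 0 s with h | h
  · have := Real.le_log_one_add_of_nonneg h
    have h3 : (1 + s) * (2 * s / (s + 2)) ≤ (1 + s) * Real.log (1 + s) := by gcongr
    have h4 : (1 + s) * (2 * s / (s + 2)) - s = s ^ 2 / (s + 2) := by field_simp; ring
    have h5 : s ^ 2 / 3 ≤ s ^ 2 / (s + 2) := by gcongr; linarith
    linarith
  · have hy : 0 < 1 + s := by linarith
    have hl : 0 ≤ Real.log (1 + s)⁻¹ := Real.log_nonneg ((one_le_inv₀ hy).mpr (by linarith))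
    have := Real.self_le_sinh_iff.mpr hl
    rw [Real.sinh_log (by positivity), Real.log_inv, inv_inv] at this
    have h3 := mul_le_mul_of_nonneg_left this hy.le
    have h4 : (1 + s) * (((1 + s)⁻¹ - (1 + s)) / 2) = (1 - (1+s)^2) / 2 := by field_simp
    nlinarith

theorem rip_tail {k n : ℕ} (hk : 0 < k) (p : Fin n → ℝ) (hp : ∀ i, 0 < p i) (hpsum : ∑ i, p i = 1)
    (v : Fin n → Fin k → ℝ) (hI : ∑ i, p i • vecMulVec (v i) (v i) = 1) (R : ℝ) (hR : 0 < R)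
    (hv : ∀ i, v i ⬝ᵥ v i ≤ R) (m : ℕ) (s ε : ℝ) (h1 : -1 < s) (h2 : s < 1) (hs : s ≠ 0) (hε : 0 < ε)
    (hm : 3 / s ^ 2 * R * Real.log (2 * k / ε) ≤ m) :
    ∑ ω : Fin m → Fin n, (∏ j, p (ω j)) *
      (trace (NormedSpace.exp (∑ j, (Real.log (1 + s) / R) • vecMulVec (v (ω j)) (v (ω j)))) *
        Real.exp (- (Real.log (1 + s) / R * ((1 + s) * m)))) ≤ ε / 2 := by
  have h := rip_mgf hk p hp hpsum v hI (Real.log (1 + s) / R) R hR hv m 0 (by simp)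
  simp only [zero_add, NormedSpace.exp_zero, trace_one, Fintype.card_fin] at h
  rw [div_mul_cancel₀ _ hR.ne', Real.exp_log (by linarith), add_sub_cancel_left] at h
  simp only [← mul_assoc]
  rw [← Finset.sum_mul]
  have hk' : (0:ℝ) < k := by exact_mod_cast hk
  have hs2 : 0 < s ^ 2 := by positivity
  calc _ ≤ (Real.exp (m * (s / R)) * k) * Real.exp (- (Real.log (1 + s) / R * ((1 + s) * m))) := by
        have := mul_le_mul_of_nonneg_right h (Real.exp_pos (- (Real.log (1 + s) / R * ((1 + s) * m)))).le
        simpa only [mul_assoc] using this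
    _ = k * Real.exp (- (m / R * ((1 + s) * Real.log (1 + s) - s))) := by
        rw [mul_comm (Real.exp _) (k:ℝ), mul_assoc, ← Real.exp_add]; congr 2; field_simp; ring
    _ ≤ k * Real.exp (- Real.log (2 * k / ε)) := by
        gcongr
        calc Real.log (2 * k / ε) = (3 / s ^ 2 * R * Real.log (2 * k / ε)) / R * (s ^ 2 / 3) := by field_simp
          _ ≤ m / R * (s ^ 2 / 3) := by gcongr
          _ ≤ _ := by gcongr; exact rip_log s h1 h2
    _ = ε / 2 := by
        rw [Real.exp_neg, Real.exp_log (by positivity)]; field_simp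

/- Restricted isometry property: if `m ≥ (3/δ²)(ν_p^k)² log(2k/ε)`, then with probability
at least `1-ε` over `m` indices drawn i.i.d. from `p`, the weighted sampling matrix
`(1/√m) M P^{-1/2}` is a restricted isometry on `span(U_k)` with constant `δ`.
The probability of an event is expressed as the sum of `∏ j, p (ω j)` over outcomes
`ω : Fin m → Fin n` in the event. -/
open Classical in
theorem restricted_isometry_property (n k m : ℕ) (hn : 0 < n) (hk : 0 < k) (hkn : k ≤ n)
    (hm : 0 < m)
    (Uk : Matrix (Fin n) (Fin k) ℝ) (hU : Uk.transpose * Uk = 1)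
    (p : Fin n → ℝ) (hp : ∀ i, 0 < p i) (hpsum : ∑ i, p i = 1)
    (δ ε : ℝ) (hδ0 : 0 < δ) (hδ1 : δ < 1) (hε0 : 0 < ε) (hε1 : ε < 1)
    (hmLB : (3 / δ ^ 2) *
        (Finset.univ.sup' (Finset.univ_nonempty_iff.mpr ⟨⟨0, hn⟩⟩)
          (fun i => (Real.sqrt (p i))⁻¹ * norm2 (Uk.transpose.mulVec (Pi.single i 1)))) ^ 2 *
        Real.log (2 * k / ε) ≤ m) :
    1 - ε ≤ ∑ ω : Fin m → Fin n,
      if (∀ x : Fin n → ℝ, (∃ α : Fin k → ℝ, x = Uk.mulVec α) →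
            (1 - δ) * norm2 x ^ 2 ≤ (1 / m) * norm2 ((sampMat ω * pInvSqrt p).mulVec x) ^ 2 ∧
            (1 / m) * norm2 ((sampMat ω * pInvSqrt p).mulVec x) ^ 2 ≤ (1 + δ) * norm2 x ^ 2)
      then ∏ j, p (ω j) else 0 := by
  set v : Fin n → Fin k → ℝ := fun i a => (Real.sqrt (p i))⁻¹ * Uk i a with hvdef
  set ν := Finset.univ.sup' (Finset.univ_nonempty_iff.mpr ⟨⟨0, hn⟩⟩)
          (fun i => (Real.sqrt (p i))⁻¹ * norm2 (Uk.transpose.mulVec (Pi.single i 1))) with hν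
  have hn2 : ∀ {d : ℕ} (x : Fin d → ℝ), norm2 x ^ 2 = x ⬝ᵥ x := by
    intro d x
    rw [norm2, Real.sq_sqrt (Finset.sum_nonneg fun i _ => sq_nonneg _)]
    simp only [dotProduct, pow_two]
  have hn0 : ∀ {d : ℕ} (x : Fin d → ℝ), 0 ≤ norm2 x := fun x => Real.sqrt_nonneg _
  have hsq : ∀ i, (Real.sqrt (p i))⁻¹ * (Real.sqrt (p i))⁻¹ = (p i)⁻¹ := by
    intro i
    rw [← mul_inv, Real.mul_self_sqrt (hp i).le]
  have hvv : ∀ i, v i ⬝ᵥ v i ≤ ν ^ 2 := by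
    intro i
    have h1 : (Real.sqrt (p i))⁻¹ * norm2 (Uk.transpose.mulVec (Pi.single i 1)) ≤ ν :=
      Finset.le_sup' (fun i => (Real.sqrt (p i))⁻¹ * norm2 (Uk.transpose.mulVec (Pi.single i 1)))
        (Finset.mem_univ i)
    have h2 : v i ⬝ᵥ v i = ((Real.sqrt (p i))⁻¹ * norm2 (Uk.transpose.mulVec (Pi.single i 1))) ^ 2 := by
      rw [mul_pow, hn2]
      simp only [hvdef, dotProduct, mulVec_single_one, col_transpose, row, Finset.mul_sum]
      exact Finset.sum_congr rfl fun a _ => by ring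
    rw [h2]
    exact pow_le_pow_left₀ (mul_nonneg (by positivity) (hn0 _)) h1 2
  have hI : ∑ i, p i • vecMulVec (v i) (v i) = 1 := by
    rw [← hU]
    ext a b
    simp only [Matrix.sum_apply, Matrix.smul_apply, vecMulVec_apply, mul_apply, transpose_apply, smul_eq_mul, hvdef]
    refine Finset.sum_congr rfl fun i _ => ?_
    have := hsq i
    have hpi := (hp i).ne'
    calc _ = p i * ((Real.sqrt (p i))⁻¹ * (Real.sqrt (p i))⁻¹) * (Uk i a * Uk i b) := by ring
      _ = _ := by rw [this, mul_inv_cancel₀ hpi, one_mul]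
  have hR : 0 < ν ^ 2 := by
    by_contra hcon
    have hz : ∀ i, v i = 0 := fun i => by
      have h0 : 0 ≤ v i ⬝ᵥ v i := Finset.sum_nonneg fun i _ => mul_self_nonneg _
      exact dotProduct_self_eq_zero.mp (le_antisymm ((hvv i).trans (not_lt.mp hcon)) h0)
    have := congrFun (congrFun hI ⟨0, hk⟩) ⟨0, hk⟩
    simp [hz] at this
  set R := ν ^ 2 with hRdef
  have T1 := rip_tail hk p hp hpsum v hI R hR hvv m δ ε (by linarith) hδ1 hδ0.ne' hε0 hmLB
  have T2 := rip_tail hk p hp hpsum v hI R hR hvv m (-δ) ε (by linarith) (by linarith)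
    (by linarith) hε0 (by rw [neg_sq]; exact hmLB)
  have htot : ∑ ω : Fin m → Fin n, ∏ j, p (ω j) = 1 := by
    rw [← Fintype.prod_sum (fun (_ : Fin m) i => p i)]
    simp [hpsum]
  have hsymm : ∀ (θ : ℝ) (ω : Fin m → Fin n), (∑ j, θ • vecMulVec (v (ω j)) (v (ω j)))ᵀ =
      ∑ j, θ • vecMulVec (v (ω j)) (v (ω j)) := by
    intro θ ω
    simp [transpose_sum, transpose_vecMulVec]
  set F : ℝ → (Fin m → Fin n) → ℝ := fun s ω =>
      (trace (NormedSpace.exp (∑ j, (Real.log (1 + s) / R) • vecMulVec (v (ω j)) (v (ω j)))) *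
        Real.exp (- (Real.log (1 + s) / R * ((1 + s) * m)))) with hF
  -- quadratic form
  have hquad : ∀ (θ : ℝ) (ω : Fin m → Fin n) (α : Fin k → ℝ),
      α ⬝ᵥ (∑ j, θ • vecMulVec (v (ω j)) (v (ω j))) *ᵥ α = θ * ∑ j, (v (ω j) ⬝ᵥ α) ^ 2 := by
    intro θ ω α
    rw [sum_mulVec, dotProduct_sum, Finset.mul_sum]
    refine Finset.sum_congr rfl fun j _ => ?_
    rw [smul_mulVec, dotProduct_smul, vecMulVec_mulVec, smul_eq_mul]
    simp only [op_smul_eq_smul, dotProduct_smul, smul_eq_mul]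
    rw [dotProduct_comm α]; ring
  have hmk : ∀ (s : ℝ) (ω : Fin m → Fin n) (β : Fin k → ℝ), β ⬝ᵥ β = 1 →
      Real.log (1 + s) * ((1 + s) * m) ≤ Real.log (1 + s) * ∑ j, (v (ω j) ⬝ᵥ β) ^ 2 → 1 ≤ F s ω := by
    intro s ω β hβ h
    have h1 := rip_markov _ (hsymm (Real.log (1 + s) / R) ω) β hβ
    rw [hquad] at h1
    rw [hF]
    simp only
    rw [Real.exp_neg, ← div_eq_mul_inv, one_le_div (Real.exp_pos _)]
    refine le_trans ?_ h1
    rw [Real.exp_le_exp, div_mul_eq_mul_div, div_mul_eq_mul_div]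
    gcongr
  have hF0 : ∀ s ω, 0 ≤ F s ω := by
    intro s ω
    have h1 := rip_markov _ (hsymm (Real.log (1 + s) / R) ω) (Pi.single ⟨0, hk⟩ 1) (by simp)
    exact mul_nonneg ((Real.exp_pos _).le.trans h1) (Real.exp_pos _).le
  have hm' : (0:ℝ) < m := by exact_mod_cast hm
  -- good event
  have hgood : ∀ ω : Fin m → Fin n, F δ ω < 1 → F (-δ) ω < 1 →
      (∀ x : Fin n → ℝ, (∃ α : Fin k → ℝ, x = Uk.mulVec α) →
            (1 - δ) * norm2 x ^ 2 ≤ (1 / m) * norm2 ((sampMat ω * pInvSqrt p).mulVec x) ^ 2 ∧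
            (1 / m) * norm2 ((sampMat ω * pInvSqrt p).mulVec x) ^ 2 ≤ (1 + δ) * norm2 x ^ 2) := by
    intro ω hu hl x hx
    obtain ⟨α, rfl⟩ := hx
    have e1 : norm2 (Uk *ᵥ α) ^ 2 = α ⬝ᵥ α := by
      rw [hn2, dotProduct_mulVec, ← mulVec_transpose, mulVec_mulVec, hU, one_mulVec]
    have e2 : norm2 ((sampMat ω * pInvSqrt p).mulVec (Uk *ᵥ α)) ^ 2 = ∑ j, (v (ω j) ⬝ᵥ α) ^ 2 := by
      rw [hn2]
      simp only [dotProduct]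
      refine Finset.sum_congr rfl fun j _ => ?_
      have : ((sampMat ω * pInvSqrt p) *ᵥ (Uk *ᵥ α)) j = ∑ a, v (ω j) a * α a := by
        rw [← mulVec_mulVec]
        simp only [sampMat, pInvSqrt, mulVec, dotProduct, of_apply, ite_mul, one_mul, zero_mul,
          Finset.sum_ite_eq', Finset.sum_ite_eq, Finset.mem_univ, if_true, diagonal_apply]
        rw [Finset.mul_sum]
        simp only [hvdef, mul_assoc]
      rw [this, pow_two]
    rw [e1, e2]
    rcases eq_or_ne α 0 with h0 | h0
    · subst h0; simp
    have hq : 0 < α ⬝ᵥ α := by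
      have h0' : 0 ≤ α ⬝ᵥ α := Finset.sum_nonneg fun i _ => mul_self_nonneg _
      exact lt_of_le_of_ne h0' fun h => h0 (dotProduct_self_eq_zero.mp h.symm)
    set q := α ⬝ᵥ α with hqd
    set β := (Real.sqrt q)⁻¹ • α with hβ
    have hβ1 : β ⬝ᵥ β = 1 := by
      rw [hβ, smul_dotProduct, dotProduct_smul, ← hqd, smul_eq_mul, smul_eq_mul, ← mul_assoc, ← mul_inv,
        Real.mul_self_sqrt hq.le, inv_mul_cancel₀ hq.ne']
    have hβs : ∑ j, (v (ω j) ⬝ᵥ β) ^ 2 = (∑ j, (v (ω j) ⬝ᵥ α) ^ 2) / q := by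
      rw [Finset.sum_div]
      refine Finset.sum_congr rfl fun j _ => ?_
      rw [hβ, dotProduct_smul, smul_eq_mul, mul_pow, inv_pow, Real.sq_sqrt hq.le]; ring
    set S := ∑ j, (v (ω j) ⬝ᵥ α) ^ 2 with hS
    constructor
    · by_contra hc
      push Not at hc
      refine absurd (hmk (-δ) ω β hβ1 ?_) (not_le.mpr hl)
      have hlog : Real.log (1 + -δ) ≤ 0 := Real.log_nonpos (by linarith) (by linarith)
      refine mul_le_mul_of_nonpos_left ?_ hlog
      rw [hβs, div_le_iff₀ hq]
      rw [one_div, inv_mul_lt_iff₀ hm'] at hc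
      linarith
    · by_contra hc
      push Not at hc
      refine absurd (hmk δ ω β hβ1 ?_) (not_le.mpr hu)
      have hlog : 0 ≤ Real.log (1 + δ) := Real.log_nonneg (by linarith)
      refine mul_le_mul_of_nonneg_left ?_ hlog
      rw [hβs, le_div_iff₀ hq]
      rw [one_div, lt_inv_mul_iff₀ hm'] at hc
      linarith
  have hfin : ∑ ω : Fin m → Fin n, ∏ j, p (ω j) ≤ ∑ ω : Fin m → Fin n,
      ((if (∀ x : Fin n → ℝ, (∃ α : Fin k → ℝ, x = Uk.mulVec α) →
            (1 - δ) * norm2 x ^ 2 ≤ (1 / m) * norm2 ((sampMat ω * pInvSqrt p).mulVec x) ^ 2 ∧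
            (1 / m) * norm2 ((sampMat ω * pInvSqrt p).mulVec x) ^ 2 ≤ (1 + δ) * norm2 x ^ 2)
      then ∏ j, p (ω j) else 0) + ((∏ j, p (ω j)) * F δ ω + (∏ j, p (ω j)) * F (-δ) ω)) := by
    refine Finset.sum_le_sum fun ω _ => ?_
    have hP : 0 ≤ ∏ j, p (ω j) := Finset.prod_nonneg fun j _ => (hp _).le
    have a1 := mul_nonneg hP (hF0 δ ω)
    have a2 := mul_nonneg hP (hF0 (-δ) ω)
    split_ifs with hg
    · linarith
    · by_cases hu : F δ ω < 1
      · by_cases hl : F (-δ) ω < 1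
        · exact absurd (hgood ω hu hl) hg
        · nlinarith
      · nlinarith
  rw [htot, Finset.sum_add_distrib, Finset.sum_add_distrib] at hfin
  linarith
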